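/- arXiv:math/0307204 — 2 statements merged into one kernel-verified Lean document; each statement's English description precedes it below -/
import Mathlib

section
/- Fix integers p ≥ 1 and k ≥ 1 with 2k ≤ p, and t ∈ (0,1). Then ∫_{ℝ^p} e_{2k}(x_1,…,x_p) · f̂(t;x) dx = (−1)^k · p! / ( (p−2k)! · 2^k · k! ) · (t(1−t))^k, where e_m denotes the m-th elementary symmetric polynomial in p variables; moreover, for every odd m with 1 ≤ m ≤ p, ∫_{ℝ^p} e_m(x_1,…,x_p) · f̂(t;x) dx = 0. -/
open MeasureTheory

open Classical in
/-- The density `f̂(t;x)` of the continuous `p`-watermelon without wall condition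
at time `t`. -/
noncomputable def fHat (p : ℕ) (t : ℝ) (x : Fin p → ℝ) : ℝ :=
  if ∀ i j : Fin p, i ≤ j → x i ≤ x j then
    2 ^ (-(p : ℝ) / 2) * Real.pi ^ (-(p : ℝ) / 2) *
      (t * (1 - t)) ^ (-((p : ℝ) ^ 2 / 2)) *
      (∏ i ∈ Finset.range (p - 1), (Nat.factorial (i + 1) : ℝ))⁻¹ *
      (∏ i : Fin p, ∏ j ∈ Finset.Ioi i, (x j - x i) ^ 2) *
      Real.exp (-(∑ i, (x i) ^ 2) / (2 * t * (1 - t)))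
  else 0

open Polynomial in
/-- The monic Hermite polynomials orthogonal for the centred Gaussian of variance `s`. -/
noncomputable def varHermite (s : ℝ) : ℕ → ℝ[X]
  | 0 => 1
  | n + 1 => X * varHermite s n - C s * derivative (varHermite s n)

section Hermite

open Polynomial

theorem pow_mul_coeff_varHermite (r : ℝ) (n j : ℕ) :
    r ^ j * (varHermite (r ^ 2) n).coeff j = r ^ n * ((hermite n).coeff j : ℝ) := by
  induction n generalizing j with
  | zero => cases j <;> simp [varHermite, coeff_one]
  | succ n ih =>
    cases j with
    | zero =>
      have h := ih 1
      simp only [varHermite, coeff_sub, coeff_C_mul, coeff_derivative, coeff_X_mul_zero,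
        coeff_hermite_succ_zero]
      push_cast
      linear_combination -r * h
    | succ j =>
      have h := ih j
      have h' := ih (j + 2)
      simp only [varHermite, coeff_sub, coeff_C_mul, coeff_derivative, coeff_X_mul,
        coeff_hermite_succ_succ]
      push_cast
      linear_combination r * h - r * (j + 2) * h'

theorem coeff_varHermite_of_lt {r : ℝ} (hr : r ≠ 0) {n j : ℕ} (h : n < j) :
    (varHermite (r ^ 2) n).coeff j = 0 := by
  have := pow_mul_coeff_varHermite r n j
  rw [coeff_hermite_of_lt h] at this
  simpa [hr] using this

theorem coeff_varHermite_self {r : ℝ} (hr : r ≠ 0) (n : ℕ) :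
    (varHermite (r ^ 2) n).coeff n = 1 := by
  have := pow_mul_coeff_varHermite r n n
  rw [coeff_hermite_self] at this
  simpa [hr] using this

theorem natDegree_varHermite {s : ℝ} (hs : 0 < s) (n : ℕ) : (varHermite s n).natDegree = n := by
  obtain ⟨r, hr, rfl⟩ : ∃ r : ℝ, r ≠ 0 ∧ s = r ^ 2 :=
    ⟨√s, (Real.sqrt_pos.2 hs).ne', (Real.sq_sqrt hs.le).symm⟩
  refine natDegree_eq_of_le_of_coeff_ne_zero ?_ (by simp [coeff_varHermite_self hr])
  exact natDegree_le_iff_coeff_eq_zero.2 fun j hj => coeff_varHermite_of_lt hr hj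

theorem monic_varHermite {s : ℝ} (hs : 0 < s) (n : ℕ) : (varHermite s n).Monic := by
  rw [Monic, leadingCoeff, natDegree_varHermite hs]
  obtain ⟨r, hr, rfl⟩ : ∃ r : ℝ, r ≠ 0 ∧ s = r ^ 2 :=
    ⟨√s, (Real.sqrt_pos.2 hs).ne', (Real.sq_sqrt hs.le).symm⟩
  exact coeff_varHermite_self hr n

theorem coeff_varHermite_of_odd {s : ℝ} (hs : 0 < s) {n j : ℕ} (h : Odd (n + j)) :
    (varHermite s n).coeff j = 0 := by
  obtain ⟨r, hr, rfl⟩ : ∃ r : ℝ, r ≠ 0 ∧ s = r ^ 2 :=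
    ⟨√s, (Real.sqrt_pos.2 hs).ne', (Real.sq_sqrt hs.le).symm⟩
  have := pow_mul_coeff_varHermite r n j
  rw [coeff_hermite_of_odd_add h] at this
  simpa [hr] using this

theorem factorial_two_mul_eq_doubleFactorial (k : ℕ) :
    (2 * k).factorial = (2 * k - 1).doubleFactorial * (2 ^ k * k.factorial) := by
  cases k with
  | zero => simp
  | succ k =>
    rw [← Nat.doubleFactorial_two_mul, show 2 * (k + 1) = (2 * k + 1) + 1 by ring,
      Nat.factorial_eq_mul_doubleFactorial, mul_comm]
    rfl

theorem coeff_varHermite_two_mul_add {s : ℝ} (hs : 0 < s) (k j : ℕ) :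
    (varHermite s (2 * k + j)).coeff j =
      (-1) ^ k * ((2 * k + j).factorial : ℝ) / (j.factorial * 2 ^ k * k.factorial) * s ^ k := by
  obtain ⟨r, hr, rfl⟩ : ∃ r : ℝ, r ≠ 0 ∧ s = r ^ 2 :=
    ⟨√s, (Real.sqrt_pos.2 hs).ne', (Real.sq_sqrt hs.le).symm⟩
  have h := pow_mul_coeff_varHermite r (2 * k + j) j
  rw [coeff_hermite_explicit, pow_add, mul_comm (r ^ (2 * k)), mul_assoc,
    mul_right_inj' (pow_ne_zero _ hr)] at h
  have h1 := Nat.add_choose_mul_factorial_mul_factorial (2 * k) j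
  rw [factorial_two_mul_eq_doubleFactorial] at h1
  have h2 : ((2 * k + j).factorial : ℝ) = ((2 * k + j).choose j) *
      ((2 * k - 1).doubleFactorial * (2 ^ k * k.factorial)) * j.factorial := by
    rw [← h1]; push_cast; ring
  rw [h, h2, ← pow_mul]
  push_cast
  field_simp

end Hermite

section Gaussian

open Polynomial

theorem integrable_eval_mul_gaussian {s : ℝ} (hs : 0 < s) (P : ℝ[X]) :
    Integrable fun x : ℝ => P.eval x * Real.exp (-x ^ 2 / (2 * s)) := by
  induction P using Polynomial.induction_on' with
  | add p q hp hq => simpa only [eval_add, add_mul] using! hp.add hq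
  | monomial n a =>
    have := (integrable_rpow_mul_exp_neg_mul_sq (b := 1 / (2 * s)) (by positivity)
      (s := n) (by linarith [(Nat.cast_nonneg n : (0 : ℝ) ≤ n)])).const_mul a
    convert this using 2 with x
    rw [eval_monomial, Real.rpow_natCast, mul_assoc]
    congr 3
    ring

/-- Integration by parts against the Gaussian weight. -/
theorem integral_X_mul_gaussian {s : ℝ} (hs : 0 < s) (P : ℝ[X]) :
    ∫ x : ℝ, (X * P).eval x * Real.exp (-x ^ 2 / (2 * s)) =
      ∫ x : ℝ, (C s * derivative P).eval x * Real.exp (-x ^ 2 / (2 * s)) := by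
  have h : ∀ x : ℝ, HasDerivAt (fun x : ℝ => (C s * P).eval x * Real.exp (-x ^ 2 / (2 * s)))
      ((C s * derivative P - X * P).eval x * Real.exp (-x ^ 2 / (2 * s))) x := by
    intro x
    have h1 : HasDerivAt (fun x : ℝ => -x ^ 2 / (2 * s)) (-x / s) x := by
      refine (((hasDerivAt_pow 2 x).neg).div_const (2 * s)).congr_deriv ?_
      field_simp
      norm_num
    refine (((C s * P).hasDerivAt x).mul h1.exp).congr_deriv ?_
    simp only [derivative_C_mul, eval_sub, eval_mul, eval_C, eval_X]
    field_simp
    ring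
  have h0 := integral_eq_zero_of_hasDerivAt_of_integrable h
    (integrable_eval_mul_gaussian hs _) (integrable_eval_mul_gaussian hs _)
  simp only [eval_sub (R := ℝ), sub_mul] at h0
  rw [integral_sub (integrable_eval_mul_gaussian hs _) (integrable_eval_mul_gaussian hs _)] at h0
  linarith

theorem integral_varHermite_mul {s : ℝ} (hs : 0 < s) (n : ℕ) (Q : ℝ[X]) :
    ∫ x : ℝ, (varHermite s n * Q).eval x * Real.exp (-x ^ 2 / (2 * s)) =
      s ^ n * ∫ x : ℝ, (derivative^[n] Q).eval x * Real.exp (-x ^ 2 / (2 * s)) := by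
  induction n generalizing Q with
  | zero => simp [varHermite]
  | succ n ih =>
    have hsplit : varHermite s (n + 1) * Q =
        X * (varHermite s n * Q) - C s * (derivative (varHermite s n) * Q) := by
      rw [varHermite]; ring
    simp only [hsplit, eval_sub (R := ℝ), sub_mul]
    rw [integral_sub (integrable_eval_mul_gaussian hs _) (integrable_eval_mul_gaussian hs _),
      integral_X_mul_gaussian hs,
      ← integral_sub (integrable_eval_mul_gaussian hs _) (integrable_eval_mul_gaussian hs _)]
    have hd : ∀ x : ℝ, (C s * derivative (varHermite s n * Q)).eval x *
        Real.exp (-x ^ 2 / (2 * s)) - (C s * (derivative (varHermite s n) * Q)).eval x *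
        Real.exp (-x ^ 2 / (2 * s)) =
        s * ((varHermite s n * derivative Q).eval x * Real.exp (-x ^ 2 / (2 * s))) := by
      intro x
      simp only [derivative_mul, eval_mul, eval_add, eval_C]
      ring
    simp only [hd]
    rw [integral_const_mul, ih, Function.iterate_succ_apply, pow_succ]
    ring

theorem integral_varHermite_mul_of_lt {s : ℝ} (hs : 0 < s) {m n : ℕ} (h : m < n) :
    ∫ x : ℝ, (varHermite s n * varHermite s m).eval x * Real.exp (-x ^ 2 / (2 * s)) = 0 := by
  rw [integral_varHermite_mul hs,
    iterate_derivative_eq_zero (by rwa [natDegree_varHermite hs])]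
  simp

theorem integral_varHermite_mul_of_ne {s : ℝ} (hs : 0 < s) {m n : ℕ} (h : m ≠ n) :
    ∫ x : ℝ, (varHermite s n * varHermite s m).eval x * Real.exp (-x ^ 2 / (2 * s)) = 0 := by
  rcases h.lt_or_gt with h | h
  · exact integral_varHermite_mul_of_lt hs h
  · rw [mul_comm]
    exact integral_varHermite_mul_of_lt hs h

theorem integral_varHermite_mul_self {s : ℝ} (hs : 0 < s) (n : ℕ) :
    ∫ x : ℝ, (varHermite s n * varHermite s n).eval x * Real.exp (-x ^ 2 / (2 * s)) =
      s ^ n * (n.factorial * √(2 * Real.pi * s)) := by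
  have h1 : derivative^[n] (varHermite s n) = C (n.factorial : ℝ) := by
    have h2 : (derivative^[n] (varHermite s n)).natDegree ≤ 0 := by
      simpa [natDegree_varHermite hs] using natDegree_iterate_derivative (varHermite s n) n
    rw [eq_C_of_natDegree_le_zero h2, coeff_iterate_derivative]
    have h3 := monic_varHermite hs n
    rw [Monic, leadingCoeff, natDegree_varHermite hs] at h3
    simp [h3, Nat.descFactorial_self]
  have h4 := integral_gaussian (1 / (2 * s))
  have h5 (x : ℝ) : -(1 / (2 * s)) * x ^ 2 = -x ^ 2 / (2 * s) := by ring
  have h6 : Real.pi / (1 / (2 * s)) = 2 * Real.pi * s := by field_simp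
  simp only [h5, h6] at h4
  rw [integral_varHermite_mul hs, h1]
  simp only [eval_C]
  rw [integral_const_mul, h4]

end Gaussian

section Andreief

open Polynomial

theorem integrable_prod_eval_mul_gaussian {ι : Type*} [Fintype ι] {s : ℝ} (hs : 0 < s) (f : ι → ℝ[X]) :
    Integrable fun x : ι → ℝ => ∏ i, ((f i).eval (x i) * Real.exp (-x i ^ 2 / (2 * s))) :=
  Integrable.fintype_prod (f := fun i (v : ℝ) => (f i).eval v * Real.exp (-v ^ 2 / (2 * s)))
    fun i => integrable_eval_mul_gaussian hs (f i)

variable {ι : Type*} [Fintype ι] [DecidableEq ι]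

theorem det_mul_det_mul_gaussian_eq_sum (s : ℝ) (f g : ι → ℝ[X]) (x : ι → ℝ) :
    (Matrix.of fun j i => (f j).eval (x i)).det * (Matrix.of fun j i => (g j).eval (x i)).det *
        ∏ i, Real.exp (-x i ^ 2 / (2 * s)) =
      ∑ τ : Equiv.Perm ι, ∑ σ : Equiv.Perm ι,
        (((Equiv.Perm.sign σ : ℤ) : ℝ) * ((Equiv.Perm.sign τ : ℤ) : ℝ)) *
          ∏ i, ((f (σ i) * g (τ i)).eval (x i) * Real.exp (-x i ^ 2 / (2 * s))) := by
  rw [Matrix.det_apply', Matrix.det_apply', Finset.sum_mul_sum, Finset.sum_mul, Finset.sum_comm]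
  simp only [Finset.sum_mul, Matrix.of_apply, eval_mul, Finset.prod_mul_distrib]
  refine Finset.sum_congr rfl fun τ _ => Finset.sum_congr rfl fun σ _ => ?_
  ring

theorem integrable_det_mul_det_mul_gaussian {s : ℝ} (hs : 0 < s) (f g : ι → ℝ[X]) :
    Integrable fun x : ι → ℝ => (Matrix.of fun j i => (f j).eval (x i)).det *
      (Matrix.of fun j i => (g j).eval (x i)).det * ∏ i, Real.exp (-x i ^ 2 / (2 * s)) := by
  simp only [det_mul_det_mul_gaussian_eq_sum]
  exact integrable_finsetSum _ fun τ _ => integrable_finsetSum _ fun σ _ =>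
    (integrable_prod_eval_mul_gaussian hs fun i => f (σ i) * g (τ i)).const_mul _

/-- Andréief's identity for polynomials and the Gaussian weight. -/
theorem integral_det_mul_det_mul_gaussian {s : ℝ} (hs : 0 < s) (f g : ι → ℝ[X]) :
    ∫ x : ι → ℝ, (Matrix.of fun j i => (f j).eval (x i)).det *
      (Matrix.of fun j i => (g j).eval (x i)).det * ∏ i, Real.exp (-x i ^ 2 / (2 * s)) =
    (Fintype.card ι).factorial *
      (Matrix.of fun a b => ∫ x : ℝ, (f a * g b).eval x * Real.exp (-x ^ 2 / (2 * s))).det := by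
  simp only [det_mul_det_mul_gaussian_eq_sum]
  have hint (τ σ : Equiv.Perm ι) := (integrable_prod_eval_mul_gaussian hs
    fun i => f (σ i) * g (τ i)).const_mul
      (((Equiv.Perm.sign σ : ℤ) : ℝ) * ((Equiv.Perm.sign τ : ℤ) : ℝ))
  rw [integral_finsetSum _ fun τ _ => integrable_finsetSum _ fun σ _ => hint τ σ]
  set M := Matrix.of fun a b => ∫ x : ℝ, (f a * g b).eval x * Real.exp (-x ^ 2 / (2 * s))
  have key (τ : Equiv.Perm ι) : ∫ x : ι → ℝ, ∑ σ : Equiv.Perm ι,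
      (((Equiv.Perm.sign σ : ℤ) : ℝ) * ((Equiv.Perm.sign τ : ℤ) : ℝ)) *
        ∏ i, ((f (σ i) * g (τ i)).eval (x i) * Real.exp (-x i ^ 2 / (2 * s))) = M.det := by
    rw [integral_finsetSum _ fun σ _ => hint τ σ, Matrix.det_apply',
      ← Equiv.sum_comp (Equiv.mulRight τ)]
    refine Finset.sum_congr rfl fun σ _ => ?_
    rw [integral_const_mul, integral_fintype_prod_volume_eq_prod
      (fun i (v : ℝ) => (f ((Equiv.mulRight τ σ) i) * g (τ i)).eval v *
        Real.exp (-v ^ 2 / (2 * s))), ← Equiv.prod_comp τ fun i => M (σ i) i]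
    congr 1
    simp only [Equiv.coe_mulRight, Equiv.Perm.sign_mul, Units.val_mul, Int.cast_mul, mul_assoc]
    rw [← Int.cast_mul, Int.units_coe_mul_self, Int.cast_one, mul_one]
  simp only [key, Finset.sum_const, Finset.card_univ, Fintype.card_perm, nsmul_eq_mul]

end Andreief

section Vandermonde

open Polynomial

variable {p : ℕ}

theorem det_vandermonde_eq_det_varHermite {s : ℝ} (hs : 0 < s) (x : Fin p → ℝ) :
    (Matrix.vandermonde x).det =
      (Matrix.of fun (j i : Fin p) => (varHermite s j).eval (x i)).det := by
  rw [Matrix.det_eval_matrixOfPolynomials_eq_det_vandermonde x (fun j => varHermite s j)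
    (fun j => natDegree_varHermite hs j) (fun j => monic_varHermite hs j), ← Matrix.det_transpose]
  rfl

theorem prod_add_mul_det_vandermonde {s : ℝ} (hs : 0 < s) (x : Fin p → ℝ) (y : ℝ) :
    (∏ i, (y + x i)) * (Matrix.vandermonde x).det =
      ∑ j : Fin (p + 1), (-1) ^ (j : ℕ) * (varHermite s j).eval (-y) *
        (Matrix.of fun (a i : Fin p) => (varHermite s (j.succAbove a)).eval (x i)).det := by
  have h1 : (∏ i, (y + x i)) * (Matrix.vandermonde x).det =
      (Matrix.vandermonde (Fin.cons (-y) x : Fin (p + 1) → ℝ)).det := by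
    rw [Matrix.det_vandermonde, Matrix.det_vandermonde, Fin.prod_univ_succ]
    simp [Fin.prod_Ioi_succ, add_comm]
  rw [h1, det_vandermonde_eq_det_varHermite hs, ← Matrix.det_transpose, Matrix.det_succ_row_zero]
  refine Finset.sum_congr rfl fun j _ => ?_
  congr 1
  rw [← Matrix.det_transpose]
  rfl

/-- The average characteristic polynomial of the Gaussian unitary ensemble is a Hermite
polynomial. -/
theorem integral_prod_add_mul_det_vandermonde_sq {s : ℝ} (hs : 0 < s) (p : ℕ) (y : ℝ) :
    ∫ x : Fin p → ℝ, (∏ i, (y + x i)) * ((Matrix.vandermonde x).det ^ 2 *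
        ∏ i, Real.exp (-x i ^ 2 / (2 * s))) =
      (-1) ^ p * (varHermite s p).eval (-y) *
        (p.factorial * ∏ j ∈ Finset.range p, (s ^ j * (j.factorial * √(2 * Real.pi * s)))) := by
  have hexp (x : Fin p → ℝ) : (∏ i, (y + x i)) * ((Matrix.vandermonde x).det ^ 2 *
        ∏ i, Real.exp (-x i ^ 2 / (2 * s))) =
      ∑ j : Fin (p + 1), (-1) ^ (j : ℕ) * (varHermite s j).eval (-y) *
        ((Matrix.of fun (a i : Fin p) => (varHermite s (j.succAbove a)).eval (x i)).det *
          (Matrix.of fun (a i : Fin p) => (varHermite s a).eval (x i)).det *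
          ∏ i, Real.exp (-x i ^ 2 / (2 * s))) := by
    rw [sq, ← mul_assoc, ← mul_assoc, prod_add_mul_det_vandermonde hs,
      det_vandermonde_eq_det_varHermite hs, mul_assoc, Finset.sum_mul]
    exact Finset.sum_congr rfl fun j _ => by ring
  simp only [hexp]
  rw [integral_finsetSum _ fun j _ => (integrable_det_mul_det_mul_gaussian hs
    (fun a : Fin p => varHermite s (j.succAbove a)) (fun a : Fin p => varHermite s a)).const_mul _,
    Finset.sum_eq_single (Fin.last p)]
  · rw [integral_const_mul, integral_det_mul_det_mul_gaussian hs
      (fun a : Fin p => varHermite s ((Fin.last p).succAbove a))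
      (fun a : Fin p => varHermite s a), Fintype.card_fin]
    simp only [Fin.succAbove_last, Fin.val_castSucc, Fin.val_last]
    congr 2
    rw [← Fin.prod_univ_eq_prod_range (fun j => s ^ j * (j.factorial * √(2 * Real.pi * s))) p,
      ← Matrix.det_diagonal]
    congr 1
    ext a b
    rw [Matrix.of_apply]
    rcases eq_or_ne a b with rfl | hab
    · rw [integral_varHermite_mul_self hs, Matrix.diagonal_apply_eq]
    · rw [integral_varHermite_mul_of_ne hs (fun h => hab (Fin.ext h.symm)),
        Matrix.diagonal_apply_ne _ hab]
  · intro j _ hj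
    rw [integral_const_mul, integral_det_mul_det_mul_gaussian hs
      (fun a : Fin p => varHermite s (j.succAbove a)) (fun a : Fin p => varHermite s a)]
    obtain ⟨a, ha⟩ := Fin.exists_succAbove_eq hj.symm
    rw [Matrix.det_eq_zero_of_row_eq_zero a, mul_zero, mul_zero]
    intro b
    simp only [Matrix.of_apply, ha, Fin.val_last]
    exact integral_varHermite_mul_of_lt hs b.2
  · simp

end Vandermonde

section Symmetrization

theorem integral_comp_perm {ι : Type*} [Fintype ι] (σ : Equiv.Perm ι) (F : (ι → ℝ) → ℝ) :
    ∫ x : ι → ℝ, F (x ∘ σ) = ∫ x, F x := by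
  have h := volume_measurePreserving_piCongrLeft (fun _ : ι => ℝ) σ.symm
  rw [← h.integral_comp' F]
  congr 1 with x
  congr 1 with i
  simp [MeasurableEquiv.piCongrLeft, Equiv.piCongrLeft_apply]

/-- Integration of a symmetric function over the Weyl chamber. -/
theorem integral_eq_factorial_mul_setIntegral_monotone {p : ℕ} {G : (Fin p → ℝ) → ℝ}
    (hG : Integrable G) (hsymm : ∀ (σ : Equiv.Perm (Fin p)) x, G (x ∘ σ) = G x)
    (hzero : ∀ x, ¬ Function.Injective x → G x = 0) :
    ∫ x, G x = p.factorial * ∫ x in {x : Fin p → ℝ | Monotone x}, G x := by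
  have hmeas : MeasurableSet {x : Fin p → ℝ | Monotone x} := isClosed_monotone.measurableSet
  set F := {x : Fin p → ℝ | Monotone x}.indicator G with hF
  have hFint : Integrable F := hG.indicator hmeas
  have hsum (x : Fin p → ℝ) : G x = ∑ σ : Equiv.Perm (Fin p), F (x ∘ σ) := by
    by_cases hx : Function.Injective x
    · rw [Finset.sum_eq_single (Tuple.sort x)]
      · rw [hF, Set.indicator_of_mem (by exact Tuple.monotone_sort x), hsymm]
      · intro σ _ hσ
        refine Set.indicator_of_notMem (fun hm => hσ ?_) _
        have := Tuple.unique_monotone hm (Tuple.monotone_sort x)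
        exact Equiv.ext fun i => hx (congrFun this i)
      · simp
    · rw [hzero x hx, Finset.sum_eq_zero]
      intro σ _
      rw [hF, Set.indicator_apply, hsymm, hzero x hx, ite_self]
  have hint (σ : Equiv.Perm (Fin p)) : Integrable fun x : Fin p → ℝ => F (x ∘ σ) := by
    have h := volume_measurePreserving_piCongrLeft (fun _ : Fin p => ℝ) σ.symm
    have h2 := (h.integrable_comp_emb (MeasurableEquiv.measurableEmbedding _) (g := F)).2 hFint
    convert h2 using 2 with x
    simp only [Function.comp_apply]
    congr 1 with i
    simp [MeasurableEquiv.piCongrLeft, Equiv.piCongrLeft_apply]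
  calc ∫ x, G x = ∫ x, ∑ σ : Equiv.Perm (Fin p), F (x ∘ σ) := by simp only [← hsum]
    _ = ∑ σ : Equiv.Perm (Fin p), ∫ x, F (x ∘ σ) := integral_finsetSum _ fun σ _ => hint σ
    _ = p.factorial * ∫ x, F x := by
      simp [integral_comp_perm, Fintype.card_perm]
    _ = _ := by rw [hF, integral_indicator hmeas]

end Symmetrization

section ElementarySymmetric

open Polynomial

variable {p : ℕ}

theorem integrable_mvPolynomial_eval_mul_gaussian {s : ℝ} (hs : 0 < s)
    (P : MvPolynomial (Fin p) ℝ) :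
    Integrable fun x : Fin p → ℝ =>
      MvPolynomial.eval x P * ∏ i, Real.exp (-x i ^ 2 / (2 * s)) := by
  induction P using MvPolynomial.induction_on' with
  | add P Q hP hQ => simpa only [map_add, add_mul] using! hP.add hQ
  | monomial u a =>
    convert (integrable_prod_eval_mul_gaussian hs fun i => (X : ℝ[X]) ^ u i).const_mul a using 2
      with x
    rw [MvPolynomial.eval_monomial, Finsupp.prod_fintype _ _ fun i => pow_zero _]
    simp [Finset.prod_mul_distrib, mul_assoc]

/-- The `m`-th elementary symmetric polynomial times the unnormalized density of the Gaussian
unitary ensemble of variance `s`. -/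
noncomputable def esymmGUE (p m : ℕ) (s : ℝ) (x : Fin p → ℝ) : ℝ :=
  (∑ S ∈ Finset.powersetCard m (Finset.univ : Finset (Fin p)), ∏ i ∈ S, x i) *
    ((Matrix.vandermonde x).det ^ 2 * ∏ i, Real.exp (-x i ^ 2 / (2 * s)))

theorem integrable_esymmGUE {s : ℝ} (hs : 0 < s) (m : ℕ) : Integrable (esymmGUE p m s) := by
  convert integrable_mvPolynomial_eval_mul_gaussian hs (MvPolynomial.esymm (Fin p) ℝ m *
    (∏ i : Fin p, ∏ j ∈ Finset.Ioi i, (MvPolynomial.X j - MvPolynomial.X i)) ^ 2) using 2 with x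
  simp [esymmGUE, MvPolynomial.esymm, Matrix.det_vandermonde, mul_assoc]

theorem esymmGUE_comp_perm (m : ℕ) (s : ℝ) (σ : Equiv.Perm (Fin p)) (x : Fin p → ℝ) :
    esymmGUE p m s (x ∘ σ) = esymmGUE p m s x := by
  have h1 (z : Fin p → ℝ) : ∑ S ∈ Finset.powersetCard m (Finset.univ : Finset (Fin p)),
      ∏ i ∈ S, z i = MvPolynomial.eval z (MvPolynomial.esymm (Fin p) ℝ m) := by
    simp [MvPolynomial.esymm]
  have h2 : (Matrix.vandermonde (x ∘ σ)).det ^ 2 = (Matrix.vandermonde x).det ^ 2 := by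
    rw [show Matrix.vandermonde (x ∘ σ) = (Matrix.vandermonde x).submatrix σ id from rfl,
      Matrix.det_permute, mul_pow]
    norm_cast
    simp
  rw [esymmGUE, esymmGUE, h1, h1, h2, ← MvPolynomial.eval_rename,
    MvPolynomial.esymm_isSymmetric (Fin p) ℝ m σ]
  congr 2
  exact Equiv.prod_comp σ fun i => Real.exp (-x i ^ 2 / (2 * s))

theorem esymmGUE_of_not_injective (m : ℕ) (s : ℝ) {x : Fin p → ℝ} (hx : ¬ Function.Injective x) :
    esymmGUE p m s x = 0 := by
  have : (Matrix.vandermonde x).det = 0 := by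
    rwa [← not_ne_iff, Matrix.det_vandermonde_ne_zero_iff]
  simp [esymmGUE, this]

theorem prod_add_eq_sum_esymm (x : Fin p → ℝ) (y : ℝ) :
    ∏ i, (y + x i) = ∑ k ∈ Finset.range (p + 1),
      (∑ S ∈ Finset.powersetCard (p - k) (Finset.univ : Finset (Fin p)), ∏ i ∈ S, x i) *
        y ^ k := by
  have h1 : ∏ i, (y + x i) = (∏ i, ((X : ℝ[X]) + C (x i))).eval y := by
    simp [eval_prod]
  have h2 : (∏ i, ((X : ℝ[X]) + C (x i))).natDegree < p + 1 := by
    rw [natDegree_prod_of_monic _ _ fun i _ => monic_X_add_C (x i)]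
    simp
  rw [h1, eval_eq_sum_range' h2]
  refine Finset.sum_congr rfl fun k hk => ?_
  rw [Finset.prod_X_add_C_coeff _ _ (by simpa [Nat.lt_succ_iff] using hk), Finset.card_univ,
    Fintype.card_fin]

theorem integral_esymmGUE {s : ℝ} (hs : 0 < s) {m : ℕ} (hm : m ≤ p) :
    ∫ x, esymmGUE p m s x = (-1) ^ m * (varHermite s p).coeff (p - m) *
      (p.factorial * ∏ j ∈ Finset.range p, (s ^ j * (j.factorial * √(2 * Real.pi * s)))) := by
  set D := p.factorial * ∏ j ∈ Finset.range p, (s ^ j * (j.factorial * √(2 * Real.pi * s)))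
  have key : ∑ k ∈ Finset.range (p + 1), C (∫ x, esymmGUE p (p - k) s x) * X ^ k =
      ∑ k ∈ Finset.range (p + 1),
        C ((-1) ^ p * ((varHermite s p).coeff k * (-1) ^ k) * D) * X ^ k := by
    refine Polynomial.funext fun y => ?_
    have h := integral_prod_add_mul_det_vandermonde_sq hs p y
    have h2 : (varHermite s p).natDegree < p + 1 := by simp [natDegree_varHermite hs]
    have h3 (x : Fin p → ℝ) : (∏ i, (y + x i)) * ((Matrix.vandermonde x).det ^ 2 *
        ∏ i, Real.exp (-x i ^ 2 / (2 * s))) =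
        ∑ k ∈ Finset.range (p + 1), esymmGUE p (p - k) s x * y ^ k := by
      rw [prod_add_eq_sum_esymm, Finset.sum_mul]
      exact Finset.sum_congr rfl fun k _ => mul_right_comm _ _ _
    simp only [h3] at h
    rw [integral_finsetSum _ fun k _ => ((integrable_esymmGUE hs (p - k)).mul_const (y ^ k)),
      eval_eq_sum_range' h2] at h
    simp only [integral_mul_const] at h
    simp only [eval_finsetSum, eval_mul, eval_C, eval_pow, eval_X]
    refine h.trans ?_
    rw [Finset.mul_sum, Finset.sum_mul]
    refine Finset.sum_congr rfl fun k _ => ?_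
    rw [neg_pow]
    ring
  have h := congrArg (fun P : ℝ[X] => P.coeff (p - m)) key
  simp only [finsetSum_coeff, coeff_C_mul_X_pow, Finset.sum_ite_eq, Finset.mem_range,
    show p - m < p + 1 by lia, if_true, Nat.sub_sub_self hm] at h
  rw [h]
  have hsign : (-1 : ℝ) ^ p * (-1) ^ (p - m) = (-1) ^ m := by
    obtain ⟨d, rfl⟩ := Nat.exists_eq_add_of_le hm
    rw [Nat.add_sub_cancel_left, pow_add, mul_assoc, ← mul_pow]
    simp
  rw [← hsign]
  ring

theorem fHat_normalization {s : ℝ} (hs : 0 < s) (p : ℕ) :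
    (2 : ℝ) ^ (-(p : ℝ) / 2) * Real.pi ^ (-(p : ℝ) / 2) * s ^ (-((p : ℝ) ^ 2 / 2)) *
      (∏ i ∈ Finset.range (p - 1), (Nat.factorial (i + 1) : ℝ))⁻¹ *
      ∏ j ∈ Finset.range p, (s ^ j * (j.factorial * √(2 * Real.pi * s))) = 1 := by
  have hpi := Real.pi_pos
  have hfac : ∏ j ∈ Finset.range p, (j.factorial : ℝ) =
      ∏ i ∈ Finset.range (p - 1), (Nat.factorial (i + 1) : ℝ) := by
    cases p with
    | zero => simp
    | succ n => simp [Finset.prod_range_succ']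
  have hne : ∏ i ∈ Finset.range (p - 1), (Nat.factorial (i + 1) : ℝ) ≠ 0 :=
    Finset.prod_ne_zero_iff.2 fun i _ => by positivity
  have hsum : ((∑ j ∈ Finset.range p, j : ℕ) : ℝ) = p * (p - 1) / 2 := by
    have := Finset.sum_range_id_mul_two p
    cases p with
    | zero => simp
    | succ n =>
      have h : ((∑ j ∈ Finset.range (n + 1), j : ℕ) : ℝ) * 2 = (n + 1) * n := by exact_mod_cast this
      push_cast at h ⊢
      linarith
  have hsqrt : √(2 * Real.pi * s) ^ p =
      2 ^ ((p : ℝ) / 2) * Real.pi ^ ((p : ℝ) / 2) * s ^ ((p : ℝ) / 2) := by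
    rw [Real.sqrt_eq_rpow, ← Real.rpow_mul_natCast (by positivity),
      Real.mul_rpow (by positivity) hs.le, Real.mul_rpow (by positivity) hpi.le]
    ring_nf
  have hspow : s ^ ((p : ℝ) * (p - 1) / 2) * s ^ ((p : ℝ) / 2) = s ^ ((p : ℝ) ^ 2 / 2) := by
    rw [← Real.rpow_add hs]
    ring_nf
  rw [Finset.prod_mul_distrib, Finset.prod_mul_distrib, Finset.prod_pow_eq_pow_sum, hfac,
    Finset.prod_const, Finset.card_range, ← Real.rpow_natCast s, hsum, hsqrt, neg_div,
    Real.rpow_neg (by positivity), Real.rpow_neg hpi.le, Real.rpow_neg hs.le, ← hspow]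
  field_simp

theorem integral_esymm_mul_fHat {t : ℝ} (ht0 : 0 < t) (ht1 : t < 1) {m : ℕ} (hm : m ≤ p) :
    ∫ x : Fin p → ℝ, (∑ S ∈ Finset.powersetCard m (Finset.univ : Finset (Fin p)),
      ∏ i ∈ S, x i) * fHat p t x =
    (-1) ^ m * (varHermite (t * (1 - t)) p).coeff (p - m) := by
  have hs : 0 < t * (1 - t) := mul_pos ht0 (by linarith)
  set c : ℝ := 2 ^ (-(p : ℝ) / 2) * Real.pi ^ (-(p : ℝ) / 2) *
      (t * (1 - t)) ^ (-((p : ℝ) ^ 2 / 2)) *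
      (∏ i ∈ Finset.range (p - 1), (Nat.factorial (i + 1) : ℝ))⁻¹ with hc
  have hmeas : MeasurableSet {x : Fin p → ℝ | Monotone x} := isClosed_monotone.measurableSet
  have hpt (x : Fin p → ℝ) : (∑ S ∈ Finset.powersetCard m (Finset.univ : Finset (Fin p)),
      ∏ i ∈ S, x i) * fHat p t x =
      {x : Fin p → ℝ | Monotone x}.indicator (fun x => c * esymmGUE p m (t * (1 - t)) x) x := by
    by_cases hx : Monotone x
    · rw [Set.indicator_of_mem (by exact hx), fHat, if_pos fun i j h => hx h, esymmGUE,
        Matrix.det_vandermonde, ← Real.exp_sum, ← Finset.sum_div, Finset.sum_neg_distrib]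
      simp only [Finset.prod_pow, mul_assoc, hc]
      ring
    · rw [Set.indicator_of_notMem (by exact hx), fHat, if_neg fun h => hx fun i j => h i j,
        mul_zero]
  have hsym := integral_eq_factorial_mul_setIntegral_monotone (integrable_esymmGUE hs m)
    (esymmGUE_comp_perm m (t * (1 - t))) (fun x => esymmGUE_of_not_injective (p := p) m _)
  rw [integral_esymmGUE hs hm, mul_left_comm,
    mul_right_inj' (Nat.cast_ne_zero.2 p.factorial_ne_zero)] at hsym
  simp only [hpt]
  rw [integral_indicator hmeas, integral_const_mul, ← hsym, mul_left_comm,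
    fHat_normalization hs, mul_one]

end ElementarySymmetric

/-- expectations of the elementary symmetric polynomials of the
branch positions of the continuous `p`-watermelon without wall condition at
time `t`: the even ones are `(−1)^k p! / ((p−2k)! 2^k k!) (t(1−t))^k` and the
odd ones vanish. -/
theorem melonNW_esymm_expectation (p k : ℕ) (hp : 1 ≤ p) (hk1 : 1 ≤ k) (hkp : 2 * k ≤ p)
    (t : ℝ) (ht0 : 0 < t) (ht1 : t < 1) :
    ((∫ x : Fin p → ℝ,
        (∑ S ∈ Finset.powersetCard (2 * k) (Finset.univ : Finset (Fin p)),
          ∏ i ∈ S, x i) * fHat p t x)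
      = (-1 : ℝ) ^ k * (Nat.factorial p : ℝ)
          / ((Nat.factorial (p - 2 * k) : ℝ) * 2 ^ k * (Nat.factorial k : ℝ))
        * (t * (1 - t)) ^ k)
    ∧ ∀ m : ℕ, Odd m → 1 ≤ m → m ≤ p →
      (∫ x : Fin p → ℝ,
        (∑ S ∈ Finset.powersetCard m (Finset.univ : Finset (Fin p)),
          ∏ i ∈ S, x i) * fHat p t x) = 0 := by
  have hs : 0 < t * (1 - t) := mul_pos ht0 (by linarith)
  refine ⟨?_, fun m hm _ hmp => ?_⟩
  · rw [integral_esymm_mul_fHat ht0 ht1 hkp]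
    obtain ⟨j, rfl⟩ := Nat.exists_eq_add_of_le hkp
    rw [Nat.add_sub_cancel_left, coeff_varHermite_two_mul_add hs, pow_mul]
    simp
  · rw [integral_esymm_mul_fHat ht0 ht1 hmp, coeff_varHermite_of_odd hs, mul_zero]
    obtain ⟨j, rfl⟩ := Nat.exists_eq_add_of_le hmp
    rw [Nat.add_sub_cancel_left]
    grind
end

section
/- For every integer p ≥ 1: ∫_{0 ≤ x_1 ≤ ⋯ ≤ x_p < ∞} ∏_{1≤i<j≤p} (x_j² − x_i²)² · ∏_{i=1}^p x_i² · exp(−(x_1²+⋯+x_p²)/2) dx = (2p)! · π^{p/2} · ∏_{1≤i<j≤p} (j−i)(j+i−1) / ( 2^{3p/2} · p! ). Equivalently, for every t ∈ (0,1), ∫_{ℝ^p} f(t;x) dx = 1, i.e. f(t;·) is a probability density on ℝ^p. -/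
open MeasureTheory

/-- The normalizing constant `c_p` (indices `i < j` here are 0-indexed, so the
paper's `(j−i)(j+i−1)` becomes `(j−i)(j+i+1)`). -/
noncomputable def cW (p : ℕ) : ℝ :=
  2 ^ ((3 * (p : ℝ)) / 2) * (Nat.factorial p : ℝ) /
    ((Nat.factorial (2 * p) : ℝ) * Real.pi ^ ((p : ℝ) / 2) *
      ∏ i : Fin p, ∏ j ∈ Finset.Ioi i, ((((j : ℕ) : ℝ) - ((i : ℕ) : ℝ)) *
        (((j : ℕ) : ℝ) + ((i : ℕ) : ℝ) + 1)))

open Classical in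
/-- The density `f(t;x)` of the continuous `p`-watermelon with wall condition
at time `t`. -/
noncomputable def fW (p : ℕ) (t : ℝ) (x : Fin p → ℝ) : ℝ :=
  if (∀ i, 0 ≤ x i) ∧ (∀ i j : Fin p, i ≤ j → x i ≤ x j) then
    cW p * (t * (1 - t)) ^ (-(((p : ℝ) ^ 2) + (p : ℝ) / 2)) *
      (∏ i : Fin p, ∏ j ∈ Finset.Ioi i, ((x j) ^ 2 - (x i) ^ 2) ^ 2) *
      (∏ i : Fin p, (x i) ^ 2) *
      Real.exp (-(∑ i, (x i) ^ 2) / (2 * t * (1 - t)))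
  else 0


namespace MelonW

open Polynomial Finset

/-- A real polynomial times the Gaussian weight `exp (-x²/2)` is integrable. -/
theorem integrable_eval_mul_exp (P : ℝ[X]) :
    Integrable fun x : ℝ => P.eval x * Real.exp (-x ^ 2 / 2) := by
  induction P using Polynomial.induction_on' with
  | add p q hp hq =>
    simp only [eval_add, add_mul]
    exact hp.add hq
  | monomial n a =>
    have h := (integrable_rpow_mul_exp_neg_mul_sq (b := 1 / 2) (by norm_num)
      (s := n) (by linarith [(Nat.cast_nonneg n : (0 : ℝ) ≤ n)])).const_mul a
    refine h.congr (ae_of_all _ fun x => ?_)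
    simp only [eval_monomial, Real.rpow_natCast]
    rw [show -(1 / 2 : ℝ) * x ^ 2 = -x ^ 2 / 2 by ring]
    ring

/-- Gaussian integration by parts for polynomials. -/
theorem integral_X_mul_eval_mul_exp (P : ℝ[X]) :
    ∫ x : ℝ, (X * P).eval x * Real.exp (-x ^ 2 / 2) =
      ∫ x : ℝ, (derivative P).eval x * Real.exp (-x ^ 2 / 2) := by
  have h := integral_eq_zero_of_hasDerivAt_of_integrable
    (f := fun x : ℝ => P.eval x * Real.exp (-x ^ 2 / 2))
    (f' := fun x : ℝ => (derivative P).eval x * Real.exp (-x ^ 2 / 2) -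
      (X * P).eval x * Real.exp (-x ^ 2 / 2)) (fun x => by
        have h1 : HasDerivAt (fun x : ℝ => -x ^ 2 / 2) (-x) x := by
          have := ((hasDerivAt_pow 2 x).neg).div_const 2
          convert! this using 1
          simp
          ring
        convert! (P.hasDerivAt x).mul h1.exp using 1
        simp only [eval_mul, eval_X]
        ring)
    ((integrable_eval_mul_exp _).sub (integrable_eval_mul_exp _)) (integrable_eval_mul_exp P)
  rw [integral_sub (integrable_eval_mul_exp _) (integrable_eval_mul_exp _)] at h
  linarith

/-- The probabilists' Hermite polynomial with real coefficients. -/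
noncomputable def hermiteR (n : ℕ) : ℝ[X] := (hermite n).map (Int.castRingHom ℝ)

theorem hermiteR_succ (n : ℕ) :
    hermiteR (n + 1) = X * hermiteR n - derivative (hermiteR n) := by
  simp [hermiteR, hermite_succ, derivative_map]

theorem hermiteR_monic (n : ℕ) : (hermiteR n).Monic := (hermite_monic n).map _

theorem natDegree_hermiteR (n : ℕ) : (hermiteR n).natDegree = n := by
  rw [hermiteR, (hermite_monic n).natDegree_map, natDegree_hermite]

theorem integral_hermiteR_mul (n : ℕ) (q : ℝ[X]) :
    ∫ x : ℝ, (hermiteR n * q).eval x * Real.exp (-x ^ 2 / 2) =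
      ∫ x : ℝ, (derivative^[n] q).eval x * Real.exp (-x ^ 2 / 2) := by
  induction n generalizing q with
  | zero => simp [hermiteR]
  | succ n ih =>
    have h := integral_X_mul_eval_mul_exp (hermiteR n * q)
    rw [Function.iterate_succ_apply, ← ih]
    have e : hermiteR (n + 1) * q =
        X * (hermiteR n * q) - derivative (hermiteR n) * q := by rw [hermiteR_succ]; ring
    have e' : derivative (hermiteR n * q) =
        derivative (hermiteR n) * q + hermiteR n * derivative q := derivative_mul
    rw [e'] at h
    simp only [eval_add, add_mul] at h
    rw [integral_add (integrable_eval_mul_exp _) (integrable_eval_mul_exp _)] at h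
    rw [e]
    simp only [eval_sub, sub_mul]
    rw [integral_sub (integrable_eval_mul_exp _) (integrable_eval_mul_exp _), h]
    ring

theorem integral_hermiteR_mul_hermiteR (m n : ℕ) :
    ∫ x : ℝ, (hermiteR m * hermiteR n).eval x * Real.exp (-x ^ 2 / 2) =
      if m = n then √(2 * Real.pi) * (n.factorial : ℝ) else 0 := by
  have key : ∀ {a b : ℕ}, b < a →
      ∫ x : ℝ, (hermiteR a * hermiteR b).eval x * Real.exp (-x ^ 2 / 2) = 0 := by
    intro a b hab
    rw [integral_hermiteR_mul, iterate_derivative_eq_zero (by rwa [natDegree_hermiteR])]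
    simp
  rcases lt_trichotomy m n with h | rfl | h
  · rw [if_neg h.ne, mul_comm, key h]
  · rw [if_pos rfl, integral_hermiteR_mul]
    have hc : derivative^[m] (hermiteR m) = C (m.factorial : ℝ) := by
      have hd : (derivative^[m] (hermiteR m)).natDegree ≤ 0 := by
        simpa [natDegree_hermiteR] using natDegree_iterate_derivative (hermiteR m) m
      rw [eq_C_of_natDegree_le_zero hd, coeff_iterate_derivative, zero_add,
        Nat.descFactorial_self]
      have := hermiteR_monic m
      rw [Monic, leadingCoeff, natDegree_hermiteR] at this
      simp [this]
    have hg := integral_gaussian (1 / 2)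
    rw [hc]
    simp only [eval_C]
    rw [integral_const_mul, mul_comm]
    congr 1
    rw [show 2 * Real.pi = Real.pi / (1 / 2) by ring, ← hg]
    congr 1
    ext x
    congr 1
    ring
  · rw [if_neg h.ne', key h]

/-- Hermite polynomials have the parity of their degree. -/
theorem exists_hermiteR_eq_comp (j : ℕ) :
    (∃ P : ℝ[X], hermiteR (2 * j) = P.comp (X ^ 2)) ∧
      ∃ Q : ℝ[X], hermiteR (2 * j + 1) = X * Q.comp (X ^ 2) := by
  have odd_of_even : ∀ j, (∃ P : ℝ[X], hermiteR (2 * j) = P.comp (X ^ 2)) →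
      ∃ Q : ℝ[X], hermiteR (2 * j + 1) = X * Q.comp (X ^ 2) := by
    rintro j ⟨P, hP⟩
    refine ⟨P - 2 * derivative P, ?_⟩
    rw [hermiteR_succ, hP, derivative_comp]
    simp only [derivative_X_pow, sub_comp, mul_comp, ofNat_comp]
    simp [map_ofNat C 2]
    ring
  have even : ∃ P : ℝ[X], hermiteR (2 * j) = P.comp (X ^ 2) := by
    induction j with
    | zero => exact ⟨1, by simp [hermiteR]⟩
    | succ j ih =>
      obtain ⟨Q, hQ⟩ := odd_of_even j ih
      refine ⟨X * Q - Q - 2 * X * derivative Q, ?_⟩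
      rw [show 2 * (j + 1) = 2 * j + 1 + 1 by ring, hermiteR_succ, hQ, derivative_mul,
        derivative_comp]
      simp only [derivative_X_pow, sub_comp, mul_comp, ofNat_comp, X_comp]
      simp [map_ofNat C 2]
      ring
  exact ⟨even, odd_of_even j even⟩

/-- The odd Hermite polynomials are `x * Q_j (x ^ 2)` with `Q_j` monic of degree `j`. -/
theorem exists_monic_hermiteR_odd (j : ℕ) : ∃ Q : ℝ[X], Q.Monic ∧ Q.natDegree = j ∧
    hermiteR (2 * j + 1) = X * Q.comp (X ^ 2) := by
  obtain ⟨Q, hQ⟩ := (exists_hermiteR_eq_comp j).2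
  have hm := hermiteR_monic (2 * j + 1)
  have hd := natDegree_hermiteR (2 * j + 1)
  have hX : (X ^ 2 : ℝ[X]).natDegree ≠ 0 := by simp
  have hQm : Q.Monic := by
    rw [hQ, Monic, leadingCoeff_mul, leadingCoeff_comp hX] at hm
    simpa only [leadingCoeff_X, leadingCoeff_X_pow, one_pow, one_mul, mul_one, ← Monic.def]
      using hm
  refine ⟨Q, hQm, ?_, hQ⟩
  have hne : Q.comp (X ^ 2) ≠ 0 := by
    intro h0
    rw [hQ, h0, mul_zero, natDegree_zero] at hd
    omega
  rw [hQ, natDegree_mul X_ne_zero hne, natDegree_comp, natDegree_X, natDegree_X_pow] at hd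
  omega

/-- Orthogonal functions: squared norm of the associated Slater determinant. -/
theorem integral_det_sq {n : ℕ} (μ : Measure ℝ) [SigmaFinite μ] (φ : Fin n → ℝ → ℝ) (h : Fin n → ℝ)
    (hint : ∀ i j, Integrable (fun x => φ i x * φ j x) μ)
    (horth : ∀ i j, ∫ x, φ i x * φ j x ∂μ = if i = j then h i else 0) :
    Integrable (fun x : Fin n → ℝ => (Matrix.det (Matrix.of fun i j => φ i (x j))) ^ 2)
      (Measure.pi fun _ => μ) ∧
    ∫ x : Fin n → ℝ, (Matrix.det (Matrix.of fun i j => φ i (x j))) ^ 2 ∂(Measure.pi fun _ => μ) =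
      n.factorial * ∏ i, h i := by
  have expand : ∀ x : Fin n → ℝ, (Matrix.det (Matrix.of fun i j => φ i (x j))) ^ 2 =
      ∑ σ : Equiv.Perm (Fin n), ∑ τ : Equiv.Perm (Fin n),
        ((Equiv.Perm.sign σ : ℤ) : ℝ) * ((Equiv.Perm.sign τ : ℤ) : ℝ) *
          ∏ i, (φ (σ i) (x i) * φ (τ i) (x i)) := by
    intro x
    rw [sq, Matrix.det_apply', Finset.sum_mul_sum]
    refine sum_congr rfl fun σ _ => sum_congr rfl fun τ _ => ?_
    rw [prod_mul_distrib]
    simp only [Matrix.of_apply]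
    ring
  have hI : ∀ σ τ : Equiv.Perm (Fin n), Integrable (fun x : Fin n → ℝ =>
      ((Equiv.Perm.sign σ : ℤ) : ℝ) * ((Equiv.Perm.sign τ : ℤ) : ℝ) *
          ∏ i, (φ (σ i) (x i) * φ (τ i) (x i))) (Measure.pi fun _ => μ) := fun σ τ =>
    (Integrable.fintype_prod (f := fun i y => φ (σ i) y * φ (τ i) y)
      fun i => hint _ _).const_mul _
  simp_rw [expand]
  refine ⟨integrable_finsetSum _ fun σ _ => integrable_finsetSum _ fun τ _ => hI σ τ, ?_⟩
  rw [integral_finsetSum _ fun σ _ => integrable_finsetSum _ fun τ _ => hI σ τ]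
  have inner : ∀ σ : Equiv.Perm (Fin n), ∫ x : Fin n → ℝ, ∑ τ : Equiv.Perm (Fin n),
        ((Equiv.Perm.sign σ : ℤ) : ℝ) * ((Equiv.Perm.sign τ : ℤ) : ℝ) *
          ∏ i, (φ (σ i) (x i) * φ (τ i) (x i)) ∂(Measure.pi fun _ => μ) = ∏ i, h i := by
    intro σ
    rw [integral_finsetSum _ fun τ _ => hI σ τ, sum_eq_single σ]
    · rw [integral_const_mul,
        integral_fintype_prod_eq_prod (fun i y => φ (σ i) y * φ (σ i) y)]
      simp only [horth, if_true]
      rw [Equiv.prod_comp σ h, ← Int.cast_mul, ← Units.val_mul, Int.units_mul_self]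
      simp
    · intro τ _ hne
      rw [integral_const_mul,
        integral_fintype_prod_eq_prod (fun i y => φ (σ i) y * φ (τ i) y)]
      obtain ⟨i, hi⟩ : ∃ i, σ i ≠ τ i := by
        by_contra! hcon
        exact hne (Equiv.ext fun i => (hcon i).symm)
      rw [prod_eq_zero (mem_univ i) (by rw [horth, if_neg hi]), mul_zero]
    · simp
  simp_rw [inner]
  simp [Fintype.card_perm]

/-- The odd Hermite functions. -/
noncomputable def oddHermiteFun (j : ℕ) (x : ℝ) : ℝ :=
  (hermiteR (2 * j + 1)).eval x * Real.exp (-x ^ 2 / 4)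

theorem oddHermiteFun_mul (i j : ℕ) (x : ℝ) : oddHermiteFun i x * oddHermiteFun j x =
    (hermiteR (2 * i + 1) * hermiteR (2 * j + 1)).eval x * Real.exp (-x ^ 2 / 2) := by
  rw [oddHermiteFun, oddHermiteFun, eval_mul,
    show -x ^ 2 / 2 = -x ^ 2 / 4 + -x ^ 2 / 4 by ring, Real.exp_add]
  ring

theorem setIntegral_oddHermiteFun_mul (i j : ℕ) :
    ∫ x in Set.Ici (0 : ℝ), oddHermiteFun i x * oddHermiteFun j x =
      if i = j then √(2 * Real.pi) * ((2 * j + 1).factorial : ℝ) / 2 else 0 := by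
  have heven : ∀ x : ℝ, oddHermiteFun i |x| * oddHermiteFun j |x| =
      oddHermiteFun i x * oddHermiteFun j x := by
    intro x
    obtain ⟨P, -, -, hP⟩ := exists_monic_hermiteR_odd i
    obtain ⟨Q, -, -, hQ⟩ := exists_monic_hermiteR_odd j
    simp only [oddHermiteFun_mul, hP, hQ, eval_mul, eval_X, eval_comp, eval_pow, sq_abs]
    linear_combination P.eval (x ^ 2) * Q.eval (x ^ 2) * Real.exp (-x ^ 2 / 2) * abs_mul_abs_self x
  have h := integral_comp_abs (f := fun x => oddHermiteFun i x * oddHermiteFun j x)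
  simp only [heven] at h
  simp_rw [oddHermiteFun_mul] at h ⊢
  rw [integral_hermiteR_mul_hermiteR] at h
  rw [integral_Ici_eq_integral_Ioi]
  have e : (2 * i + 1 = 2 * j + 1) ↔ i = j := by omega
  simp only [e] at h
  split_ifs at h ⊢ <;> linarith

theorem det_oddHermiteFun {p : ℕ} (x : Fin p → ℝ) :
    Matrix.det (Matrix.of fun i j : Fin p => oddHermiteFun i (x j)) =
      (∏ i, x i) * (∏ i, Real.exp (-x i ^ 2 / 4)) *
        ∏ i : Fin p, ∏ j ∈ Ioi i, (x j ^ 2 - x i ^ 2) := by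
  choose Q hm hd hQ using exists_monic_hermiteR_odd
  rw [← Matrix.det_vandermonde (fun i => x i ^ 2),
    Matrix.det_eval_matrixOfPolynomials_eq_det_vandermonde (fun i => x i ^ 2)
      (fun j : Fin p => Q j) (fun j => hd j) (fun j => hm j), ← prod_mul_distrib,
    ← Matrix.det_mul_column, ← Matrix.det_transpose]
  congr 1
  ext i j
  simp [oddHermiteFun, hQ]
  ring

/-- The unnormalized watermelon density at `t (1 - t) = 1`, before restricting to the chamber. -/
noncomputable def weight {p : ℕ} (x : Fin p → ℝ) : ℝ :=
  (∏ i : Fin p, ∏ j ∈ Ioi i, ((x j) ^ 2 - (x i) ^ 2) ^ 2) *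
    (∏ i : Fin p, (x i) ^ 2) * Real.exp (-(∑ i, (x i) ^ 2) / 2)

theorem weight_eq_det_sq {p : ℕ} (x : Fin p → ℝ) :
    weight x = (Matrix.det (Matrix.of fun i j : Fin p => oddHermiteFun i (x j))) ^ 2 := by
  rw [det_oddHermiteFun, weight, ← Real.exp_sum, mul_pow, mul_pow, ← Real.exp_nat_mul]
  simp only [prod_pow]
  rw [← sum_div, sum_neg_distrib]
  push_cast
  rw [show 2 * (-(∑ i, x i ^ 2) / 4) = -(∑ i, x i ^ 2) / 2 by ring]
  ring

theorem weight_comp_perm {p : ℕ} (x : Fin p → ℝ) (σ : Equiv.Perm (Fin p)) :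
    weight (x ∘ σ) = weight x := by
  rw [weight_eq_det_sq, weight_eq_det_sq]
  have h := Matrix.det_permute' σ (Matrix.of fun i j : Fin p => oddHermiteFun i (x j))
  have e : (Matrix.of fun i j : Fin p => oddHermiteFun i ((x ∘ σ) j)) =
      (Matrix.of fun i j : Fin p => oddHermiteFun i (x j)).submatrix id σ := rfl
  rw [e, h, mul_pow, ← Int.cast_pow, ← Units.val_pow_eq_pow_val, Int.units_sq]
  simp

theorem weight_eq_zero_of_not_injective {p : ℕ} {x : Fin p → ℝ} (hx : ¬ Function.Injective x) :
    weight x = 0 := by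
  rw [weight_eq_det_sq, sq_eq_zero_iff]
  simp only [Function.Injective, not_forall] at hx
  obtain ⟨i, j, hij, hne⟩ := hx
  exact Matrix.det_zero_of_column_eq hne fun k => by simp [hij]

/-- The closed Weyl chamber of type `B`. -/
def chamber (p : ℕ) : Set (Fin p → ℝ) :=
  {x | (∀ i, 0 ≤ x i) ∧ ∀ i j : Fin p, i ≤ j → x i ≤ x j}

theorem measurableSet_chamber (p : ℕ) : MeasurableSet (chamber p) := by
  have : IsClosed (chamber p) := by
    simp only [chamber, Set.ofPred_and, Set.ofPred_forall]
    refine (isClosed_iInter fun i => isClosed_le continuous_const (continuous_apply i)).inter ?_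
    exact isClosed_iInter fun i => isClosed_iInter fun j => isClosed_iInter fun _ =>
      isClosed_le (continuous_apply i) (continuous_apply j)
  exact this.measurableSet

theorem mem_pi_Ici_zero {p : ℕ} {x : Fin p → ℝ} :
    x ∈ (Set.univ.pi fun _ : Fin p => Set.Ici (0 : ℝ)) ↔ ∀ i, 0 ≤ x i :=
  ⟨fun h i => h i trivial, fun h i _ => h i⟩

theorem indicator_weight_eq_sum {p : ℕ} (x : Fin p → ℝ) :
    (Set.univ.pi fun _ : Fin p => Set.Ici (0 : ℝ)).indicator weight x =
      ∑ σ : Equiv.Perm (Fin p), (chamber p).indicator weight (x ∘ σ) := by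
  by_cases hx : Function.Injective x
  · by_cases h0 : ∀ i, 0 ≤ x i
    · rw [Set.indicator_of_mem (mem_pi_Ici_zero.2 h0), sum_eq_single (Tuple.sort x)]
      · rw [Set.indicator_of_mem, weight_comp_perm]
        exact ⟨fun i => h0 _, fun i j hij => Tuple.monotone_sort x hij⟩
      · intro σ _ hne
        refine Set.indicator_of_notMem (fun hm => hne ?_) _
        have hmono : Monotone (x ∘ σ) := fun i j hij => hm.2 i j hij
        have := Tuple.unique_monotone hmono (Tuple.monotone_sort x)
        exact Equiv.ext fun i => hx (congrFun this i)
      · simp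
    · rw [Set.indicator_of_notMem (mt mem_pi_Ici_zero.1 h0)]
      refine (sum_eq_zero fun σ _ => Set.indicator_of_notMem (fun hm => h0 fun i => ?_) _).symm
      simpa using hm.1 (σ.symm i)
  · have h := weight_eq_zero_of_not_injective hx
    rw [Set.indicator_apply_eq_zero.2 fun _ => h]
    refine (sum_eq_zero fun σ _ => Set.indicator_apply_eq_zero.2 fun _ => ?_).symm
    rw [weight_comp_perm, h]

theorem integral_orthant_weight (p : ℕ) :
    IntegrableOn weight (Set.univ.pi fun _ : Fin p => Set.Ici (0 : ℝ)) ∧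
    ∫ x in Set.univ.pi fun _ : Fin p => Set.Ici (0 : ℝ), weight x =
      p.factorial * ∏ j : Fin p, (√(2 * Real.pi) * ((2 * (j : ℕ) + 1).factorial : ℝ) / 2) := by
  have h := integral_det_sq (n := p) (volume.restrict (Set.Ici 0)) (fun j => oddHermiteFun j)
    (fun j => √(2 * Real.pi) * ((2 * (j : ℕ) + 1).factorial : ℝ) / 2)
    (fun i j => by
      simp_rw [oddHermiteFun_mul]
      exact (integrable_eval_mul_exp _).restrict)
    (fun i j => by 
      rw [setIntegral_oddHermiteFun_mul]
      by_cases h : i = j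
      · simp [h]
      · simp [h, Fin.val_inj])
  rw [IntegrableOn, volume_pi, Measure.restrict_pi_pi]
  simpa only [← weight_eq_det_sq] using! h

theorem integral_chamber_weight (p : ℕ) :
    ∫ x in chamber p, weight x =
      ∏ j : Fin p, (√(2 * Real.pi) * ((2 * (j : ℕ) + 1).factorial : ℝ) / 2) := by
  obtain ⟨hI, h⟩ := integral_orthant_weight p
  have hC : Integrable ((chamber p).indicator weight) :=
    (hI.mono_set fun x hx => mem_pi_Ici_zero.2 hx.1).integrable_indicator
      (measurableSet_chamber p)
  have hmp : ∀ σ : Equiv.Perm (Fin p),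
      MeasurePreserving (MeasurableEquiv.piCongrLeft (fun _ => ℝ) σ.symm) volume volume :=
    fun σ => volume_measurePreserving_piCongrLeft (fun _ : Fin p => ℝ) σ.symm
  have happ : ∀ (σ : Equiv.Perm (Fin p)) (x : Fin p → ℝ),
      MeasurableEquiv.piCongrLeft (fun _ => ℝ) σ.symm x = x ∘ σ := fun σ x => by
    ext i
    rw [MeasurableEquiv.coe_piCongrLeft]
    simpa using Equiv.piCongrLeft_apply_apply (fun _ : Fin p => ℝ) σ.symm x (σ i)
  have hint : ∀ σ : Equiv.Perm (Fin p),
      ∫ x : Fin p → ℝ, (chamber p).indicator weight (x ∘ σ) = ∫ x in chamber p, weight x := by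
    intro σ
    rw [← integral_indicator (measurableSet_chamber p),
      ← (hmp σ).integral_comp' ((chamber p).indicator weight)]
    simp only [happ]
  have hinteg : ∀ σ : Equiv.Perm (Fin p),
      Integrable fun x : Fin p → ℝ => (chamber p).indicator weight (x ∘ σ) := by
    intro σ
    have := ((hmp σ).integrable_comp_emb (MeasurableEquiv.measurableEmbedding _)).2 hC
    simpa only [Function.comp_def, happ] using! this
  rw [← integral_indicator (MeasurableSet.univ_pi fun _ => measurableSet_Ici)] at h
  simp_rw [indicator_weight_eq_sum] at h
  rw [integral_finsetSum _ fun σ _ => hinteg σ] at h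
  simp only [hint, sum_const, card_univ, Fintype.card_perm, Fintype.card_fin, nsmul_eq_mul] at h
  exact mul_left_cancel₀ (by exact_mod_cast p.factorial_ne_zero) h

theorem prod_fin_Ioi_eq_prod_range {M : Type*} [CommMonoid M] (p : ℕ) (g : ℕ → ℕ → M) :
    ∏ i : Fin p, ∏ j ∈ Ioi i, g i j = ∏ j ∈ range p, ∏ i ∈ range j, g i j := by
  have h1 : ∀ i : Fin p, ∏ j ∈ Ioi i, g i j = ∏ j ∈ range p, if (i : ℕ) < j then g i j else 1 := by
    intro i
    rw [← Fin.prod_univ_eq_prod_range (fun j => if (i : ℕ) < j then g i j else 1), ← prod_filter]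
    refine prod_congr ?_ fun _ _ => rfl
    ext j
    simp
  simp only [h1]
  rw [Fin.prod_univ_eq_prod_range
    (fun i => ∏ j ∈ range p, if (i : ℕ) < j then g i j else 1), prod_comm]
  refine prod_congr rfl fun j hj => ?_
  rw [← prod_filter]
  refine prod_congr ?_ fun _ _ => rfl
  ext i
  simp only [mem_filter, mem_range] at hj ⊢
  omega

theorem prod_range_sub_mul_add (j : ℕ) :
    ∏ i ∈ range j, (((j : ℝ) - i) * ((j : ℝ) + i + 1)) = ((2 * j).factorial : ℝ) := by
  have h1 : ∀ k ≤ j, (∏ i ∈ range k, (((j : ℝ) - i) * ((j : ℝ) + i + 1))) * ((j - k).factorial : ℝ)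
      = ((j + k).factorial : ℝ) := by
    intro k hk
    induction k with
    | zero => simp
    | succ k ih =>
      rw [← add_assoc, Nat.factorial_succ, prod_range_succ]
      push_cast
      rw [← ih (by omega), show j - k = (j - (k + 1)) + 1 by omega, Nat.factorial_succ]
      have : ((j - (k + 1) : ℕ) : ℝ) = j - (k + 1) := by
        rw [Nat.cast_sub hk]; push_cast; ring
      push_cast
      rw [this]
      ring
  simpa [two_mul] using h1 j le_rfl

theorem prod_pairs (p : ℕ) :
    ∏ i : Fin p, ∏ j ∈ Ioi i, ((((j : ℕ) : ℝ) - ((i : ℕ) : ℝ)) *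
      (((j : ℕ) : ℝ) + ((i : ℕ) : ℝ) + 1)) = ∏ j ∈ range p, ((2 * j).factorial : ℝ) := by
  rw [prod_fin_Ioi_eq_prod_range p fun i j : ℕ => ((j : ℝ) - i) * ((j : ℝ) + i + 1)]
  exact prod_congr rfl fun j _ => prod_range_sub_mul_add j

theorem prod_range_factorial (p : ℕ) :
    2 ^ p * (p.factorial : ℝ) * ∏ j ∈ range p, ((2 * j + 1).factorial : ℝ) =
      ((2 * p).factorial : ℝ) * ∏ j ∈ range p, ((2 * j).factorial : ℝ) := by
  induction p with
  | zero => simp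
  | succ p ih =>
    rw [prod_range_succ, prod_range_succ, show 2 * (p + 1) = 2 * p + 1 + 1 by ring,
      Nat.factorial_succ (2 * p + 1), Nat.factorial_succ p]
    push_cast
    linear_combination (2 * (p + 1) * ((2 * p + 1).factorial : ℝ)) * ih

theorem integral_chamber_weight_eq (p : ℕ) :
    ∫ x in chamber p, weight x =
      (Nat.factorial (2 * p) : ℝ) * Real.pi ^ ((p : ℝ) / 2) *
          (∏ i : Fin p, ∏ j ∈ Ioi i, ((((j : ℕ) : ℝ) - ((i : ℕ) : ℝ)) *
            (((j : ℕ) : ℝ) + ((i : ℕ) : ℝ) + 1)))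
          / (2 ^ ((3 * (p : ℝ)) / 2) * (Nat.factorial p : ℝ)) := by
  rw [integral_chamber_weight, prod_pairs,
    Fin.prod_univ_eq_prod_range (fun j => √(2 * Real.pi) * ((2 * j + 1).factorial : ℝ) / 2) p,
    prod_div_distrib, prod_mul_distrib, prod_const, prod_const, card_range]
  have e1 : √(2 * Real.pi) ^ p = 2 ^ ((p : ℝ) / 2) * Real.pi ^ ((p : ℝ) / 2) := by
    rw [← Real.mul_rpow (by norm_num) Real.pi_pos.le, Real.sqrt_eq_rpow, ← Real.rpow_natCast,
      ← Real.rpow_mul (by positivity)]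
    congr 1
    ring
  have e2 : (2 : ℝ) ^ ((3 * (p : ℝ)) / 2) = 2 ^ p * 2 ^ ((p : ℝ) / 2) := by
    rw [← Real.rpow_natCast, ← Real.rpow_add (by norm_num)]
    congr 1
    ring
  have e3 : (2 : ℝ) ^ ((p : ℝ) / 2) * 2 ^ ((p : ℝ) / 2) = 2 ^ p := by
    rw [← Real.rpow_natCast, ← Real.rpow_add (by norm_num)]
    congr 1
    ring
  have hf : (p.factorial : ℝ) ≠ 0 := by exact_mod_cast p.factorial_ne_zero
  have h2 : (2 : ℝ) ^ ((p : ℝ) / 2) ≠ 0 := by positivity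
  rw [e1, e2, div_eq_div_iff (by positivity) (by positivity)]
  linear_combination (Real.pi ^ ((p : ℝ) / 2) * 2 ^ p) * prod_range_factorial p +
    (Real.pi ^ ((p : ℝ) / 2) * 2 ^ p * p.factorial *
      ∏ j ∈ range p, ((2 * j + 1).factorial : ℝ)) * e3

theorem cW_mul_integral_chamber_weight (p : ℕ) : cW p * ∫ x in chamber p, weight x = 1 := by
  rw [integral_chamber_weight_eq, cW, div_mul_div_comm, mul_comm, div_self]
  rw [prod_pairs]
  positivity

theorem prod_fin_Ioi_const (p : ℕ) (c : ℝ) :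
    (∏ i : Fin p, ∏ _j ∈ Ioi i, c ^ 4) * ∏ _i : Fin p, c ^ 2 = c ^ (2 * p ^ 2) := by
  rw [prod_fin_Ioi_eq_prod_range p fun _ _ => c ^ 4]
  simp only [prod_const, card_range, card_univ, Fintype.card_fin]
  induction p with
  | zero => simp
  | succ p ih =>
    rw [prod_range_succ, show 2 * (p + 1) ^ 2 = 2 * p ^ 2 + (4 * p + 2) by ring,
      pow_add _ (2 * p ^ 2), ← ih]
    ring

theorem fW_eq_smul {p : ℕ} {t : ℝ} (h0 : 0 < t) (h1 : t < 1) (x : Fin p → ℝ) :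
    fW p t x = (cW p / √(t * (1 - t)) ^ p) *
      (chamber p).indicator weight ((√(t * (1 - t)))⁻¹ • x) := by
  have hT : 0 < t * (1 - t) := mul_pos h0 (by linarith)
  set s := √(t * (1 - t)) with hs
  have hs0 : 0 < s := Real.sqrt_pos.2 hT
  have hs2 : s ^ 2 = t * (1 - t) := Real.sq_sqrt hT.le
  obtain ⟨y, rfl⟩ : ∃ y, x = s • y := ⟨s⁻¹ • x, by rw [smul_inv_smul₀ hs0.ne']⟩
  rw [inv_smul_smul₀ hs0.ne']
  have hmem : ((∀ i, 0 ≤ (s • y) i) ∧ ∀ i j : Fin p, i ≤ j → (s • y) i ≤ (s • y) j) ↔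
      y ∈ chamber p := by
    simp only [chamber, Pi.smul_apply, smul_eq_mul, Set.mem_ofPred_eq, mul_nonneg_iff_of_pos_left hs0,
      mul_le_mul_iff_right₀ hs0]
  by_cases hy : y ∈ chamber p
  · rw [fW, if_pos (hmem.2 hy), Set.indicator_of_mem hy, weight]
    have hpow : (t * (1 - t)) ^ (-(((p : ℝ) ^ 2) + (p : ℝ) / 2)) = (s ^ (2 * p ^ 2) * s ^ p)⁻¹ := by
      rw [← hs2, ← pow_add, ← Real.rpow_natCast s 2, ← Real.rpow_natCast s (_ + _),
        ← Real.rpow_mul hs0.le,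
        ← Real.rpow_neg hs0.le]
      congr 1
      push_cast
      ring
    have hexp : -(∑ i, (s • y) i ^ 2) / (2 * t * (1 - t)) = -(∑ i, y i ^ 2) / 2 := by
      simp only [Pi.smul_apply, smul_eq_mul, mul_pow, ← mul_sum]
      rw [mul_assoc, ← hs2]
      field_simp
    have hpoly : (∏ i : Fin p, ∏ j ∈ Ioi i, ((s • y) j ^ 2 - (s • y) i ^ 2) ^ 2) *
        (∏ i : Fin p, (s • y) i ^ 2) = s ^ (2 * p ^ 2) *
          ((∏ i : Fin p, ∏ j ∈ Ioi i, (y j ^ 2 - y i ^ 2) ^ 2) * ∏ i : Fin p, y i ^ 2) := by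
      rw [← prod_fin_Ioi_const, mul_mul_mul_comm]
      congr 1 <;> simp only [← prod_mul_distrib, Pi.smul_apply, smul_eq_mul]
      · exact prod_congr rfl fun i _ => prod_congr rfl fun j _ => by ring
      · exact prod_congr rfl fun i _ => by ring
    rw [hexp, hpow, mul_assoc (cW p * _), hpoly]
    field_simp
  · rw [fW, if_neg (fun h => hy (hmem.1 h)), Set.indicator_of_notMem hy, mul_zero]

theorem integral_fW {p : ℕ} {t : ℝ} (h0 : 0 < t) (h1 : t < 1) :
    ∫ x : Fin p → ℝ, fW p t x = 1 := by
  have hs0 : 0 < √(t * (1 - t)) := Real.sqrt_pos.2 (mul_pos h0 (by linarith))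
  simp_rw [fW_eq_smul h0 h1]
  rw [integral_const_mul, Measure.integral_comp_inv_smul_of_nonneg _ _ hs0.le,
    integral_indicator (measurableSet_chamber p), Module.finrank_fin_fun, smul_eq_mul,
    ← mul_assoc, div_mul_cancel₀ _ (pow_pos hs0 p).ne', cW_mul_integral_chamber_weight]

end MelonW

/-- the Selberg-type normalization for the density of the
continuous `p`-watermelon with wall condition, and the fact that `f(t;·)` is a
probability density. (Indices `i < j` are 0-indexed here, so the paper's
`(j−i)(j+i−1)` becomes `(j−i)(j+i+1)`.) -/
theorem melonW_density_normalization (p : ℕ) (hp : 1 ≤ p) :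
    ((∫ x in {x : Fin p → ℝ | (∀ i, 0 ≤ x i) ∧ ∀ i j : Fin p, i ≤ j → x i ≤ x j},
        (∏ i : Fin p, ∏ j ∈ Finset.Ioi i, ((x j) ^ 2 - (x i) ^ 2) ^ 2) *
          (∏ i : Fin p, (x i) ^ 2) * Real.exp (-(∑ i, (x i) ^ 2) / 2))
      = (Nat.factorial (2 * p) : ℝ) * Real.pi ^ ((p : ℝ) / 2) *
          (∏ i : Fin p, ∏ j ∈ Finset.Ioi i, ((((j : ℕ) : ℝ) - ((i : ℕ) : ℝ)) *
            (((j : ℕ) : ℝ) + ((i : ℕ) : ℝ) + 1)))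
          / (2 ^ ((3 * (p : ℝ)) / 2) * (Nat.factorial p : ℝ)))
    ∧ ∀ t : ℝ, 0 < t → t < 1 → (∫ x : Fin p → ℝ, fW p t x) = 1 := by
  exact ⟨MelonW.integral_chamber_weight_eq p, fun _ h0 h1 => MelonW.integral_fW h0 h1⟩
end
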